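/- (Second-order bold self-energy coefficient) Let U(x) = (1/8) Σ_{i,j=1}^n v_{ij} x_i² x_j² be a quartic interaction with symmetric coefficient matrix v such that U has superquadratic growth. Fix a symmetric positive definite n×n matrix G. Then the second coefficient of the asymptotic series of ε ↦ Σ[G; εU] at ε = 0 is given entrywise by (Σ^(2)[G])_{ij} = ½ G_{ij} (Σ_{k,l} v_{ik} G_{kl}² v_{lj}) + Σ_{k,l} v_{ik} G_{kj} G_{kl} G_{li} v_{jl}. -/

import Mathlib

open MeasureTheory Matrix Filter Topology Real Asymptotics

attribute [local instance] Matrix.normedAddCommGroup Matrix.normedSpace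

noncomputable section

/-- The partition function `Z[A] = ∫ exp(-½ xᵀAx - U(x)) dx`. -/
def Zfun (n : ℕ) (U : (Fin n → ℝ) → ℝ) (A : Matrix (Fin n) (Fin n) ℝ) : ℝ :=
  ∫ x : Fin n → ℝ, Real.exp (-(1 / 2) * (x ⬝ᵥ A.mulVec x) - U x)

/-- The free energy `Ω[A] = -log Z[A]`. -/
def Omega (n : ℕ) (U : (Fin n → ℝ) → ℝ) (A : Matrix (Fin n) (Fin n) ℝ) : ℝ :=
  - Real.log (Zfun n U A)

/-- `U` is continuous with superquadratic growth: for every `c > 0`,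
`U x - c * |x|² → +∞` as `|x| → ∞`. -/
def SuperQuadratic {n : ℕ} (U : (Fin n → ℝ) → ℝ) : Prop :=
  Continuous U ∧ ∀ c : ℝ, 0 < c →
    Tendsto (fun x : Fin n → ℝ => U x - c * ‖x‖ ^ 2) (cocompact _) atTop

/-- A probability density on `ℝⁿ` with finite second moments and finite
differential entropy. -/
def IsGoodDensity {n : ℕ} (ρ : (Fin n → ℝ) → ℝ) : Prop :=
  Measurable ρ ∧ (∀ x, 0 ≤ ρ x) ∧ (∫ x, ρ x) = 1 ∧
  (∀ i j : Fin n, Integrable fun x => x i * x j * ρ x) ∧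
  Integrable fun x => ρ x * Real.log (ρ x)

/-- Differential entropy `S(ρ) = -∫ ρ log ρ`. -/
def entropy {n : ℕ} (ρ : (Fin n → ℝ) → ℝ) : ℝ := - ∫ x, ρ x * Real.log (ρ x)

/-- Second-moment matrix `𝒢(ρ) = ∫ x xᵀ ρ(x) dx`. -/
def momMatrix {n : ℕ} (ρ : (Fin n → ℝ) → ℝ) : Matrix (Fin n) (Fin n) ℝ :=
  Matrix.of fun i j => ∫ x, x i * x j * ρ x

/-- `𝓕[G;U] = sup { S(ρ) - ∫ U ρ : ρ ∈ 𝓜, 𝒢(ρ) = G }`. -/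
def Ffun (n : ℕ) (U : (Fin n → ℝ) → ℝ) (G : Matrix (Fin n) (Fin n) ℝ) : ℝ :=
  sSup { r : ℝ | ∃ ρ : (Fin n → ℝ) → ℝ, IsGoodDensity ρ ∧
    (Integrable fun x => U x * ρ x) ∧ momMatrix ρ = G ∧
    r = entropy ρ - ∫ x, U x * ρ x }

/-- The Luttinger-Ward functional `Φ[G;U] = 2𝓕[G;U] - Tr[log G] - n log(2πe)`.
(For positive definite `G`, `Tr[log G] = log det G`.) -/
def Phi (n : ℕ) (U : (Fin n → ℝ) → ℝ) (G : Matrix (Fin n) (Fin n) ℝ) : ℝ :=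
  2 * Ffun n U G - Real.log G.det - (n : ℝ) * Real.log (2 * π * Real.exp 1)

/-- The continuous linear functional `H ↦ Tr[S * H]` on matrices. -/
def tracePairing {n : ℕ} (S : Matrix (Fin n) (Fin n) ℝ) :
    Matrix (Fin n) (Fin n) ℝ →L[ℝ] ℝ :=
  LinearMap.toContinuousLinearMap
    { toFun := fun H => (S * H).trace
      map_add' := fun H K => by simp [Matrix.mul_add]
      map_smul' := fun c H => by simp [Matrix.mul_smul] }

section Alg
set_option linter.all false
open MvPolynomial

theorem pd_single {n : ℕ} (i k : Fin n) : pderiv k (X i : MvPolynomial (Fin n) ℝ) = if i = k then 1 else 0 := by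
  rw [pderiv_X]; by_cases h : i = k
  · subst h; simp
  · simp [h, Pi.single_apply, Ne.symm h]

theorem pd_mul {n : ℕ} (k : Fin n) (p q : MvPolynomial (Fin n) ℝ) :
    pderiv k (p * q) = p * pderiv k q + q * pderiv k p := by
  rw [pderiv_mul]; ring

theorem pd_smul {n : ℕ} (k : Fin n) (c : ℝ) (p : MvPolynomial (Fin n) ℝ) :
    pderiv k (c • p) = c • pderiv k p := Derivation.map_smul _ c p

theorem pd_add {n : ℕ} (k : Fin n) (p q : MvPolynomial (Fin n) ℝ) :
    pderiv k (p + q) = pderiv k p + pderiv k q := map_add _ _ _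

theorem pd_sum {n : ℕ} (k : Fin n) {ι : Type} (s : Finset ι) (p : ι → MvPolynomial (Fin n) ℝ) :
    pderiv k (∑ i ∈ s, p i) = ∑ i ∈ s, pderiv k (p i) := map_sum _ _ _

theorem alg_dbl {n : ℕ} (G : Fin n → Fin n → ℝ)
    (E : MvPolynomial (Fin n) ℝ →ₗ[ℝ] ℝ)
    (hIBP : ∀ i p, E (X i * p) = ∑ k, G i k * E (pderiv k p)) (i j : Fin n)
    (f : MvPolynomial (Fin n) ℝ) :
    E ((X i * X j - C (G i j)) * f) = ∑ k, ∑ l, G i k * G j l * E (pderiv l (pderiv k f)) := by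
  have h : (X i * X j - C (G i j)) * f = X i * (X j * f) - (G i j) • f := by
    rw [MvPolynomial.smul_eq_C_mul]; ring
  rw [h, map_sub, hIBP, map_smul]
  simp only [pd_mul, pd_single, mul_ite, mul_one, mul_zero, map_add, apply_ite E, map_zero, hIBP, mul_add, Finset.sum_add_distrib]
  simp [Finset.mul_sum, mul_assoc]

theorem alg_inv {n : ℕ} (G K : Matrix (Fin n) (Fin n) ℝ) (hKG : K * G = 1)
    (D : Fin n → Fin n → ℝ) (h : ∀ i j, ∑ k, ∑ l, G i k * G j l * D k l = 0) (k l : Fin n) :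
    D k l = 0 := by
  have h1 : G * Matrix.of D * G.transpose = 0 := by
    ext i j
    simp only [Matrix.mul_apply, Matrix.of_apply, Matrix.transpose_apply, Matrix.zero_apply,
      Finset.sum_mul]
    rw [← h i j, Finset.sum_comm]
    refine Finset.sum_congr rfl fun a _ => Finset.sum_congr rfl fun b _ => by ring
  have h3 : G.transpose * K.transpose = 1 := by
    rw [← Matrix.transpose_mul, hKG, Matrix.transpose_one]
  have h2 : Matrix.of D = 0 := by
    calc Matrix.of D = (K * G) * Matrix.of D * (G.transpose * K.transpose) := by
          rw [hKG, h3, Matrix.one_mul, Matrix.mul_one]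
      _ = K * (G * Matrix.of D * G.transpose) * K.transpose := by simp only [Matrix.mul_assoc]
      _ = 0 := by rw [h1]; simp
  exact congrFun (congrFun h2 k) l

noncomputable def quadP {n : ℕ} (S : Fin n → Fin n → ℝ) : MvPolynomial (Fin n) ℝ :=
  (1/2 : ℝ) • ∑ a, ∑ b, S a b • (X a * X b)

noncomputable def quarP {n : ℕ} (v : Fin n → Fin n → ℝ) : MvPolynomial (Fin n) ℝ :=
  (1/8 : ℝ) • ∑ a, ∑ b, v a b • (X a ^ 2 * X b ^ 2)

theorem pd_quad {n : ℕ} (S : Fin n → Fin n → ℝ) (hS : ∀ a b, S a b = S b a) (k : Fin n) :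
    pderiv k (quadP S) = ∑ a, S k a • X a := by
  simp only [quadP, pd_add, pd_smul, pd_sum, pd_mul, pd_single, smul_eq_mul, mul_ite, mul_one, mul_zero,
    smul_add, Finset.sum_add_distrib, smul_ite, smul_zero, Finset.sum_ite_eq', Finset.mem_univ, if_true, Finset.sum_ite_irrel, Finset.sum_const_zero]
  have : ∀ a, S a k = S k a := fun a => hS a k
  simp only [this]
  rw [← two_smul ℝ, smul_smul]; norm_num

theorem pd_quar {n : ℕ} (v : Fin n → Fin n → ℝ) (hv : ∀ a b, v a b = v b a) (k : Fin n) :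
    pderiv k (quarP v) = (1/2 : ℝ) • ∑ a, v k a • (X k * (X a * X a)) := by
  simp only [quarP, pd_add, pd_smul, pd_sum, pd_mul, pow_two, pd_single, smul_eq_mul, mul_ite, mul_one, mul_zero,
    smul_add, Finset.sum_add_distrib, smul_ite, smul_zero, Finset.sum_ite_eq', Finset.mem_univ, if_true, Finset.sum_ite_irrel, Finset.sum_const_zero, mul_add, ]
  have : ∀ a, v a k = v k a := fun a => hv a k
  simp only [this, Finset.smul_sum, smul_smul]
  simp only [← Finset.sum_add_distrib]
  refine Finset.sum_congr rfl fun a _ => ?_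
  simp only [MvPolynomial.smul_eq_C_mul, C_mul]
  have h2 : (C (1/2) : MvPolynomial (Fin n) ℝ) = 4 * C (1/8) := by
    rw [show (1/2:ℝ) = 4 * (1/8) by norm_num, C_mul]; rfl
  rw [h2]; ring

theorem pd2_W {n : ℕ} (S v : Fin n → Fin n → ℝ) (hS : ∀ a b, S a b = S b a) (hv : ∀ a b, v a b = v b a) (k l : Fin n) :
    pderiv l (pderiv k (quadP S + quarP v)) =
      C (S k l) + (if k = l then (1/2 : ℝ) • ∑ a, v k a • (X a * X a) else 0) + v k l • (X k * X l) := by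
  rw [map_add, pd_quad S hS, pd_quar v hv]
  simp only [map_add, pd_add, pd_smul, pd_sum, pd_mul, pd_single, smul_eq_mul, mul_ite, mul_one, mul_zero,
    smul_add, Finset.sum_add_distrib, smul_ite, smul_zero, Finset.sum_ite_eq', Finset.mem_univ, if_true, Finset.sum_ite_irrel, Finset.sum_const_zero, mul_add]
  have h3 : v k l • (X k * X l : MvPolynomial (Fin n) ℝ)
      = (1/2 : ℝ) • (v k l • (X k * X l)) + (1/2 : ℝ) • (v k l • (X k * X l)) := by module
  conv_rhs => rw [h3]
  split_ifs <;> simp [MvPolynomial.smul_eq_C_mul] <;> ring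

theorem alg_pair {n : ℕ} (G : Fin n → Fin n → ℝ)
    (E : MvPolynomial (Fin n) ℝ →ₗ[ℝ] ℝ) (hE1 : E 1 = 1)
    (hIBP : ∀ i p, E (X i * p) = ∑ k, G i k * E (pderiv k p)) (i j : Fin n) :
    E (X i * X j) = G i j := by
  rw [hIBP]
  simp only [pd_single, apply_ite E, hE1, map_zero]
  simp

theorem alg_pair2 {n : ℕ} (G : Fin n → Fin n → ℝ)
    (E : MvPolynomial (Fin n) ℝ →ₗ[ℝ] ℝ) (hE1 : E 1 = 1)
    (hIBP : ∀ i p, E (X i * p) = ∑ k, G i k * E (pderiv k p)) (j a b : Fin n) :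
    E ((X j * X j) * (X a * X b)) = G j j * G a b + 2 * (G j a * G j b) := by
  have hp := alg_pair G E hE1 hIBP
  rw [mul_assoc, hIBP]
  simp only [pd_mul, pd_single, mul_ite, mul_one, mul_zero, map_add, apply_ite E, map_zero, mul_add,
    Finset.sum_add_distrib]
  simp only [Finset.sum_ite_eq, Finset.mem_univ, if_true, hp]
  ring

theorem alg_main {n : ℕ} (G K : Matrix (Fin n) (Fin n) ℝ) (hKG : K * G = 1)
    (hGs : ∀ a b, G a b = G b a)
    (E : MvPolynomial (Fin n) ℝ →ₗ[ℝ] ℝ) (hE1 : E 1 = 1)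
    (hIBP : ∀ i p, E (X i * p) = ∑ k, G i k * E (pderiv k p))
    (S1 S2 v : Fin n → Fin n → ℝ)
    (hS1 : ∀ a b, S1 a b = S1 b a) (hS2 : ∀ a b, S2 a b = S2 b a) (hv : ∀ a b, v a b = v b a)
    (h1 : ∀ i j, E ((X i * X j - C (G i j)) * (quadP S1 + quarP v)) = 0)
    (h2 : ∀ i j, E ((X i * X j - C (G i j)) *
      ((1/2 : ℝ) • (quadP S1 + quarP v) ^ 2 - quadP S2)) = 0) (i j : Fin n) :
    S2 i j = (1 / 2) * G i j * (∑ k, ∑ l, v i k * (G k l) ^ 2 * v l j) +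
        ∑ k, ∑ l, v i k * G k j * G k l * G l i * v j l := by
  have hp := alg_pair G E hE1 hIBP
  have hp2 := alg_pair2 G E hE1 hIBP
  set W := quadP S1 + quarP v with hW
  have hD : ∀ k l, E (pderiv l (pderiv k W)) = 0 := by
    refine alg_inv G K hKG _ fun i j => ?_
    rw [← alg_dbl G E hIBP, h1]
  have hD2 : ∀ k l, E (pderiv l (pderiv k ((1/2 : ℝ) • W ^ 2 - quadP S2))) = 0 := by
    refine alg_inv G K hKG _ fun i j => ?_
    rw [← alg_dbl G E hIBP, h2]
  -- explicit second derivatives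
  have hC : ∀ c : ℝ, E (C c) = c := fun c => by
    rw [← mul_one (C c), ← MvPolynomial.smul_eq_C_mul, map_smul, hE1]; simp
  have hq := pd2_W S1 v hS1 hv
  have hS1v : ∀ k l, S1 k l = -((if k = l then (1/2) * ∑ a, v k a * G a a else 0) + v k l * G k l) := by
    intro k l
    have := hD k l
    rw [hW, hq] at this
    simp only [map_add, hC, apply_ite E, map_smul, map_sum, hp, map_zero, smul_eq_mul] at this
    linarith
  have hXf : ∀ a k, E (X a * pderiv k W) = 0 := by
    intro a k; rw [hIBP]; simp [hD]
  have hXXq : ∀ b k d, E ((X b * X b) * pderiv d (pderiv k W)) =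
      (if k = d then ∑ m, v k m * (G b m) ^ 2 else 0) + 2 * (v k d * G b k * G b d) := by
    intro b k d
    rw [hW, hq, hS1v k d]
    have e1 : ∀ c : ℝ, E (X b * X b * C c) = c * G b b := fun c => by
      rw [mul_comm, ← MvPolynomial.smul_eq_C_mul, map_smul, hp]; simp
    simp only [mul_add, map_add, e1, mul_ite, mul_zero, apply_ite E, mul_smul_comm, map_smul, map_zero,
      Finset.mul_sum, map_sum, hp2, smul_eq_mul]
    have : ∀ m, v k m * (G b b * G m m) + v k m * (2 * (G b m * G b m)) =
      G b b * (v k m * G m m) + 2 * (v k m * G b m ^ 2) := fun m => by ring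
    split_ifs
    · have e := Finset.sum_congr (s₁ := Finset.univ) rfl fun m _ => this m
      rw [Finset.sum_add_distrib, Finset.sum_add_distrib, ← Finset.mul_sum, ← Finset.mul_sum] at e
      rw [Finset.sum_add_distrib]
      simp only [← Finset.mul_sum]
      linear_combination (1/2) * e
    · ring
  have hXXXf : ∀ l b k, E ((X l * (X b * X b)) * pderiv k W) =
      G l k * (∑ m, v k m * (G b m) ^ 2) + 2 * ∑ d, G l d * (v k d * G b k * G b d) := by
    intro l b k
    rw [mul_assoc, hIBP]
    simp only [pd_mul, pd_single, mul_ite, mul_one, mul_zero, map_add, mul_add, apply_ite E,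
      map_zero, Finset.sum_add_distrib, hXXq]
    have e2 : E (pderiv k W * X b) = 0 := by rw [mul_comm, hXf]
    simp only [e2, ite_self, Finset.sum_const_zero, mul_ite, mul_zero, Finset.sum_ite_eq, Finset.mem_univ, if_true, add_zero]
    simp [Finset.mul_sum, mul_left_comm, e2]
  have hff : E (pderiv j W * pderiv i W) = (1 / 2) * ∑ b, v j b * E ((X j * (X b * X b)) * pderiv i W) := by
    conv_lhs => rw [hW, pd_add j, pd_quad _ hS1, pd_quar _ hv]
    simp only [add_mul, map_add, Finset.sum_mul, smul_mul_assoc, map_smul, map_sum, hXf, smul_zero, Finset.sum_const_zero, smul_eq_mul, ← hW, zero_add]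
    simp [hXf]
  have hWq : E (W * pderiv j (pderiv i W)) = 0 := by
    have e3 : ∀ a b, E (W * (X a * X b)) = G a b * E W := by
      intro a b
      have := h1 a b
      rw [sub_mul, map_sub, ← MvPolynomial.smul_eq_C_mul, map_smul, sub_eq_zero] at this
      rw [mul_comm, this]; rfl
    have e4 : ∀ c : ℝ, E (W * C c) = c * E W := fun c => by
      rw [mul_comm, ← MvPolynomial.smul_eq_C_mul, map_smul]; rfl
    have : pderiv j (pderiv i W) = _ := hq i j
    rw [this, hS1v i j]
    simp only [mul_add, map_add, e4, e3, mul_ite, mul_zero, apply_ite E, mul_smul_comm, map_smul, map_zero,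
      Finset.mul_sum, map_sum, smul_eq_mul]
    split_ifs
    · simp only [← mul_assoc, ← Finset.sum_mul, ← Finset.mul_sum]
      have : ∑ x, 1 / 2 * v i x * G x x = 1/2 * ∑ x, v i x * G x x := by
        rw [Finset.mul_sum]; exact Finset.sum_congr rfl fun _ _ => by ring
      rw [this]; ring
    · ring
  have hfin : S2 i j = E (pderiv j W * pderiv i W) + E (W * pderiv j (pderiv i W)) := by
    have := hD2 i j
    have e5 : pderiv j (pderiv i ((1/2 : ℝ) • W ^ 2 - quadP S2)) =
        pderiv j W * pderiv i W + W * pderiv j (pderiv i W) - C (S2 i j) := by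
      rw [map_sub, map_sub, pd_quad _ hS2]
      simp only [pow_two, pd_smul, pd_mul, pd_add, pd_sum, pd_single]
      simp only [smul_ite, smul_zero, Finset.sum_ite_eq', Finset.mem_univ, if_true]
      rw [show S2 i j • (1 : MvPolynomial (Fin n) ℝ) = C (S2 i j) by
        rw [MvPolynomial.smul_eq_C_mul, mul_one]]
      have hc : (C (1/2) : MvPolynomial (Fin n) ℝ) * 2 = 1 := by
        rw [show (2 : MvPolynomial (Fin n) ℝ) = C 2 from rfl, ← C_mul]; norm_num
      rw [MvPolynomial.smul_eq_C_mul]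
      linear_combination (pderiv j W * pderiv i W + W * pderiv j (pderiv i W)) * hc
    rw [e5, map_sub, map_add, hC] at this
    linarith
  rw [hfin, hWq, hff, add_zero]
  simp only [hXXXf, mul_add, Finset.sum_add_distrib, Finset.mul_sum]
  congr 1
  · rw [Finset.sum_comm]
    refine Finset.sum_congr rfl fun k _ => Finset.sum_congr rfl fun l _ => ?_
    rw [hGs j i, hv j l, hGs l k]; ring
  · rw [Finset.sum_comm]
    refine Finset.sum_congr rfl fun k _ => Finset.sum_congr rfl fun l _ => ?_
    rw [hGs j k, hGs l k]; ring

end Alg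

section Analysis1
open MvPolynomial MeasureTheory

def Qf {n : ℕ} (x : Fin n → ℝ) : ℝ := ∑ i, x i ^ 2

theorem Qf_nonneg {n : ℕ} (x : Fin n → ℝ) : 0 ≤ Qf x := Finset.sum_nonneg fun i _ => sq_nonneg _

theorem Qf_cont {n : ℕ} : Continuous (Qf (n := n)) := by unfold Qf; fun_prop

theorem ev_cont {n : ℕ} (p : MvPolynomial (Fin n) ℝ) : Continuous fun x : Fin n → ℝ => eval x p :=
  MvPolynomial.continuous_eval p

theorem int_poly0 {n : ℕ} (p : MvPolynomial (Fin n) ℝ) {κ : ℝ} (hκ : 0 < κ) :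
    Integrable fun x : Fin n → ℝ => eval x p * Real.exp (-κ * Qf x) := by
  induction p using MvPolynomial.induction_on' with
  | monomial m c =>
    have h1 : ∀ i : Fin n, Integrable fun t : ℝ => t ^ (m i) * Real.exp (-κ * t ^ 2) := by
      intro i
      have := integrable_rpow_mul_exp_neg_mul_sq hκ (s := (m i : ℝ))
        (by have : (0:ℝ) ≤ m i := Nat.cast_nonneg _
            linarith)
      simpa only [Real.rpow_natCast] using this
    have h2 := (Integrable.fintype_prod (μ := fun _ : Fin n => (volume : Measure ℝ)) h1).const_mul c
    refine h2.congr (Filter.Eventually.of_forall fun x => ?_)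
    simp only [eval_monomial, Finset.prod_mul_distrib, Qf, Finset.mul_sum, Real.exp_sum]
    rw [Finsupp.prod_fintype _ _ (by simp), mul_assoc]
  | add p q hp hq =>
    simp only [map_add, add_mul]; exact hp.add hq

theorem int_poly {n : ℕ} (p : MvPolynomial (Fin n) ℝ) {κ : ℝ} (hκ : 0 < κ) {C : ℝ}
    {g : (Fin n → ℝ) → ℝ} (hg : Continuous g) (hb : ∀ x, |g x| ≤ C * Real.exp (-κ * Qf x)) :
    Integrable fun x : Fin n → ℝ => eval x p * g x := by
  refine ((int_poly0 p hκ).norm.const_mul C).mono' ((ev_cont p).mul hg).aestronglyMeasurable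
    (Filter.Eventually.of_forall fun x => ?_)
  rw [norm_mul, norm_mul, Real.norm_eq_abs (Real.exp _), abs_of_pos (Real.exp_pos _), Real.norm_eq_abs (g x)]
  calc ‖eval x p‖ * |g x| ≤ ‖eval x p‖ * (C * Real.exp (-κ * Qf x)) := by gcongr; exact hb x
    _ = _ := by ring

theorem int_gibbs {n : ℕ} (p q : MvPolynomial (Fin n) ℝ) {κ : ℝ} (hκ : 0 < κ)
    (hq : ∀ x, κ * Qf x ≤ eval x q) :
    Integrable fun x : Fin n → ℝ => eval x p * Real.exp (-eval x q) := by
  refine int_poly p hκ (C := 1) (Real.continuous_exp.comp (ev_cont q).neg) fun x => ?_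
  rw [abs_of_pos (Real.exp_pos _), one_mul]
  exact Real.exp_le_exp.2 (by linarith [hq x])

theorem line_poly {n : ℕ} (p : MvPolynomial (Fin n) ℝ) (x : Fin n → ℝ) (j : Fin n) :
    HasLineDerivAt ℝ (fun x : Fin n → ℝ => eval x p) (eval x (pderiv j p)) x (Pi.single j 1) := by
  unfold HasLineDerivAt
  induction p using MvPolynomial.induction_on with
  | C a => simpa using hasDerivAt_const (0:ℝ) a
  | add p q hp hq => simp only [map_add]; exact hp.add hq
  | mul_X p i hp =>
    have h : HasDerivAt (fun t : ℝ => eval (x + t • (Pi.single j 1 : Fin n → ℝ)) (X i)) (eval x (pderiv j (X i))) 0 := by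
      simp only [eval_X, pd_single, Pi.add_apply, Pi.smul_apply, Pi.single_apply, smul_eq_mul]
      by_cases hij : i = j
      · simp only [hij, if_true, mul_one, map_one]
        simpa using (hasDerivAt_id (0:ℝ)).const_add (x j)
      · simp only [hij, if_false, mul_zero, map_zero, add_zero]
        exact hasDerivAt_const _ _
    refine ((hp.mul h).congr_deriv ?_).congr_of_eventuallyEq (Filter.Eventually.of_forall fun t => ?_)
    · simp only [map_mul, pd_mul, map_add, zero_smul, add_zero]; ring
    · simp only [map_mul, Pi.mul_apply]

theorem ibp_poly {n : ℕ} (p q : MvPolynomial (Fin n) ℝ) {κ : ℝ} (hκ : 0 < κ)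
    (hq : ∀ x, κ * Qf x ≤ eval x q) (j : Fin n) :
    ∫ x : Fin n → ℝ, eval x (pderiv j p) * Real.exp (-eval x q) =
      ∫ x : Fin n → ℝ, eval x (p * pderiv j q) * Real.exp (-eval x q) := by
  have hl : ∀ x : Fin n → ℝ, HasLineDerivAt ℝ (fun x : Fin n → ℝ => Real.exp (-eval x q))
      (-(eval x (pderiv j q)) * Real.exp (-eval x q)) x (Pi.single j 1) := by
    intro x
    have := (line_poly q x j)
    unfold HasLineDerivAt at this ⊢
    have h2 := this.neg.exp
    simp only [zero_smul, add_zero, Pi.neg_apply] at h2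
    exact h2.congr_deriv (by ring)
  have := integral_bilinear_hasLineDerivAt_right_eq_neg_left_of_integrable (μ := (volume : Measure (Fin n → ℝ)))
    (B := ContinuousLinearMap.mul ℝ ℝ) (f := fun x => eval x p) (f' := fun x => eval x (pderiv j p))
    (g := fun x => Real.exp (-eval x q)) (g' := fun x => -(eval x (pderiv j q)) * Real.exp (-eval x q))
    (v := Pi.single j 1)
    (int_gibbs (pderiv j p) q hκ hq)
    (by
      have := (int_gibbs (p * pderiv j q) q hκ hq).neg
      refine this.congr (Filter.Eventually.of_forall fun x => ?_)
      simp [mul_assoc])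
    (int_gibbs p q hκ hq) (fun x _ => line_poly p x j) (fun x _ => hl x)
  simp only [ContinuousLinearMap.mul_apply'] at this
  rw [← neg_eq_iff_eq_neg] at this
  rw [← this, ← integral_neg]
  congr 1; ext x; simp [mul_assoc]

/-- normalized gaussian expectation of polynomials -/
noncomputable def gE {n : ℕ} (q : MvPolynomial (Fin n) ℝ) {κ : ℝ} (hκ : 0 < κ)
    (hq : ∀ x : Fin n → ℝ, κ * Qf x ≤ eval x q) : MvPolynomial (Fin n) ℝ →ₗ[ℝ] ℝ where
  toFun p := (∫ x : Fin n → ℝ, Real.exp (-eval x q))⁻¹ * ∫ x : Fin n → ℝ, eval x p * Real.exp (-eval x q)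
  map_add' p r := by
    simp only [map_add, add_mul]
    rw [integral_add (int_gibbs p q hκ hq) (int_gibbs r q hκ hq)]; ring
  map_smul' c p := by
    simp only [smul_eval, mul_assoc, RingHom.id_apply, smul_eq_mul]
    rw [integral_const_mul]; ring

theorem gZ_pos {n : ℕ} (q : MvPolynomial (Fin n) ℝ) {κ : ℝ} (hκ : 0 < κ)
    (hq : ∀ x : Fin n → ℝ, κ * Qf x ≤ eval x q) : 0 < ∫ x : Fin n → ℝ, Real.exp (-eval x q) := by
  have h := int_gibbs 1 q hκ hq
  simp only [map_one, one_mul] at h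
  exact integral_exp_pos h

theorem gE_one {n : ℕ} (q : MvPolynomial (Fin n) ℝ) {κ : ℝ} (hκ : 0 < κ)
    (hq : ∀ x : Fin n → ℝ, κ * Qf x ≤ eval x q) : gE q hκ hq 1 = 1 := by
  simp only [gE, LinearMap.coe_mk, AddHom.coe_mk, map_one, one_mul]
  exact inv_mul_cancel₀ (gZ_pos q hκ hq).ne'

theorem gE_ibp {n : ℕ} (G K : Matrix (Fin n) (Fin n) ℝ) (hGK : G * K = 1)
    (hK : ∀ a b, K a b = K b a) {κ : ℝ} (hκ : 0 < κ)
    (hq : ∀ x : Fin n → ℝ, κ * Qf x ≤ eval x (quadP K)) (i : Fin n) (p : MvPolynomial (Fin n) ℝ) :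
    gE (quadP K) hκ hq (X i * p) = ∑ k, G i k * gE (quadP K) hκ hq (pderiv k p) := by
  have h1 : ∀ k, gE (quadP K) hκ hq (pderiv k p) = gE (quadP K) hκ hq (p * pderiv k (quadP K)) := by
    intro k
    simp only [gE, LinearMap.coe_mk, AddHom.coe_mk]
    rw [ibp_poly p _ hκ hq]
  have h2 : X i = ∑ k, G i k • pderiv k (quadP K) := by
    simp only [pd_quad K hK, Finset.smul_sum, smul_smul]
    rw [Finset.sum_comm]
    simp only [← Finset.sum_smul]
    have : ∀ a, ∑ k, G i k * K k a = (1 : Matrix (Fin n) (Fin n) ℝ) i a := by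
      intro a; rw [← hGK, Matrix.mul_apply]
    simp only [this, Matrix.one_apply]
    simp
  rw [h2, Finset.sum_mul, map_sum]
  refine Finset.sum_congr rfl fun k _ => ?_
  rw [h1, smul_mul_assoc, map_smul, mul_comm p]; rfl

end Analysis1
section Analysis2
open MvPolynomial MeasureTheory Filter Topology

noncomputable def QP (n : ℕ) : MvPolynomial (Fin n) ℝ := ∑ i, X i ^ 2

theorem ev_QP {n : ℕ} (x : Fin n → ℝ) : eval x (QP n) = Qf x := by simp [QP, Qf]

theorem ev_quad {n : ℕ} (S : Fin n → Fin n → ℝ) (x : Fin n → ℝ) :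
    eval x (quadP S) = (1/2) * ∑ a, ∑ b, S a b * (x a * x b) := by
  simp [quadP, smul_eval]

theorem ev_quar {n : ℕ} (v : Fin n → Fin n → ℝ) (x : Fin n → ℝ) :
    eval x (quarP v) = (1/8) * ∑ a, ∑ b, v a b * (x a ^ 2 * x b ^ 2) := by
  simp [quarP, smul_eval]

theorem quad_bound {n : ℕ} (S : Fin n → Fin n → ℝ) {m : ℝ} (hm : ∀ a b, |S a b| ≤ m)
    (x : Fin n → ℝ) : |eval x (quadP S)| ≤ m * n * Qf x := by
  rcases Nat.eq_zero_or_pos n with hn | hn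
  · subst hn; simp [quadP]
  have hm0 : 0 ≤ m := (abs_nonneg _).trans (hm ⟨0, hn⟩ ⟨0, hn⟩)
  rw [ev_quad, abs_mul, abs_of_pos (by norm_num : (0:ℝ) < 1/2)]
  have h1 : |∑ a, ∑ b, S a b * (x a * x b)| ≤ ∑ a, ∑ b, m * ((x a ^ 2 + x b ^ 2) / 2) := by
    refine (Finset.abs_sum_le_sum_abs _ _).trans (Finset.sum_le_sum fun a _ => ?_)
    refine (Finset.abs_sum_le_sum_abs _ _).trans (Finset.sum_le_sum fun b _ => ?_)
    rw [abs_mul]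
    refine mul_le_mul (hm a b) ?_ (abs_nonneg _) hm0
    rw [abs_le]; constructor <;> nlinarith [sq_nonneg (x a + x b), sq_nonneg (x a - x b)]
  have h2 : ∑ a, ∑ b, m * ((x a ^ 2 + x b ^ 2) / 2) = m * n * Qf x := by
    simp only [← Finset.mul_sum, ← Finset.sum_div, Finset.sum_add_distrib, Finset.sum_const, Finset.card_univ, Fintype.card_fin, nsmul_eq_mul, Qf]
    ring
  have h3 : 0 ≤ m * n * Qf x := by have := Qf_nonneg x; positivity
  linarith

theorem exp_rem (u : ℝ) {d : ℝ} (hd : 0 ≤ d) (hu : u ≤ d) : |Real.exp u - 1 - u| ≤ u ^ 2 * Real.exp d := by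
  have h0 : 0 ≤ Real.exp u - 1 - u := by linarith [Real.add_one_le_exp u]
  rw [abs_of_nonneg h0]
  have h1 : Real.exp u - 1 ≤ u * Real.exp u := by
    have h := Real.add_one_le_exp (-u)
    have h2 : (-u + 1) * Real.exp u ≤ 1 := by
      calc (-u + 1) * Real.exp u ≤ Real.exp (-u) * Real.exp u := by gcongr
        _ = 1 := by rw [← Real.exp_add]; simp
    linarith
  have h2 : Real.exp u - 1 - u ≤ u * (Real.exp u - 1) := by linarith
  refine h2.trans ?_
  rcases le_total 0 u with h | h
  · calc u * (Real.exp u - 1) ≤ u * (u * Real.exp u) := by gcongr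
      _ = u ^ 2 * Real.exp u := by ring
      _ ≤ _ := by gcongr
  · have h3 : 1 ≤ Real.exp d := Real.one_le_exp hd
    have h4 : u ≤ Real.exp u - 1 := by linarith
    nlinarith [sq_nonneg u]

theorem exp_lim {W : ℝ → ℝ} {W1 W2 : ℝ} 
    (hD : Tendsto (fun ε => (W ε - ε * W1) / ε ^ 2) (𝓝[>] 0) (𝓝 W2)) :
    Tendsto (fun ε => (Real.exp (-W ε) - 1 + ε * W1) / ε ^ 2) (𝓝[>] 0) (𝓝 (1/2 * W1 ^ 2 - W2)) := by
  have hε : Tendsto (fun ε : ℝ => ε) (𝓝[>] 0) (𝓝 0) := tendsto_id.mono_left nhdsWithin_le_nhds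
  have hpos : ∀ᶠ ε : ℝ in 𝓝[>] 0, 0 < ε := eventually_mem_nhdsWithin
  have hW1 : Tendsto (fun ε => W ε / ε) (𝓝[>] 0) (𝓝 W1) := by
    have : Tendsto (fun ε => W1 + ε * ((W ε - ε * W1) / ε ^ 2)) (𝓝[>] 0) (𝓝 (W1 + 0 * W2)) :=
      tendsto_const_nhds.add (hε.mul hD)
    rw [zero_mul, add_zero] at this
    refine this.congr' ?_
    filter_upwards [hpos] with ε h
    field_simp; ring
  have hW0 : Tendsto W (𝓝[>] 0) (𝓝 0) := by
    have := hε.mul hW1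
    rw [zero_mul] at this
    refine this.congr' ?_
    filter_upwards [hpos] with ε h
    field_simp
  have hrem : Tendsto (fun ε => (Real.exp (-W ε) - 1 + W ε - 1/2 * W ε ^ 2) / ε ^ 2) (𝓝[>] 0) (𝓝 0) := by
    have hb : Tendsto (fun ε => |W ε / ε| ^ 3 * ε) (𝓝[>] 0) (𝓝 0) := by
      have := (hW1.abs.pow 3).mul hε
      rwa [mul_zero] at this
    refine squeeze_zero_norm' ?_ hb
    have hsm : ∀ᶠ ε in 𝓝[>] (0:ℝ), |W ε| < 1 := by
      have := hW0.abs
      rw [abs_zero] at this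
      exact this.eventually (gt_mem_nhds one_pos)
    filter_upwards [hpos, hsm] with ε h1 h2
    have := Real.exp_bound (x := -W ε) (by rw [abs_neg]; exact h2.le) (n := 3) (by norm_num)
    simp only [Finset.sum_range_succ, Finset.sum_range_zero] at this
    norm_num [Nat.factorial] at this
    rw [norm_div, Real.norm_eq_abs, Real.norm_eq_abs, abs_of_pos (by positivity : 0 < ε ^ 2), abs_div, abs_of_pos h1]
    rw [div_le_iff₀ (by positivity)]
    have e : (|W ε| / ε) ^ 3 * ε * ε ^ 2 = |W ε| ^ 3 := by field_simp
    rw [e]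
    have e2 : Real.exp (-W ε) - 1 + W ε - 1/2 * W ε ^ 2 = Real.exp (-W ε) - (1 + -W ε + W ε ^ 2 / 2) := by ring
    rw [e2]
    refine this.trans ?_
    have : 0 ≤ |W ε| ^ 3 := by positivity
    linarith
  have := (hrem.add ((hW1.pow 2).const_mul (1/2))).sub hD
  rw [zero_add] at this
  refine this.congr' ?_
  filter_upwards [hpos] with ε h
  field_simp; ring

theorem asym {n : ℕ} (K : Fin n → Fin n → ℝ) {κ : ℝ} (hκ : 0 < κ)
    (hq : ∀ x : Fin n → ℝ, κ * Qf x ≤ eval x (quadP K)) (P : MvPolynomial (Fin n) ℝ)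
    (v : Fin n → Fin n → ℝ) (hv : ∀ x : Fin n → ℝ, 0 ≤ eval x (quarP v))
    (Sig : ℝ → Fin n → Fin n → ℝ) (S1 S2 : Fin n → Fin n → ℝ) (c0 : ℝ)
    (hs1 : ∀ᶠ ε in 𝓝[>] (0:ℝ), ∀ a b, |Sig ε a b - ε * S1 a b| ≤ c0 * ε ^ 2)
    (hs2 : ∀ a b, Tendsto (fun ε => (Sig ε a b - ε * S1 a b) / ε ^ 2) (𝓝[>] 0) (𝓝 (S2 a b)))
    (hz : ∀ᶠ ε in 𝓝[>] (0:ℝ), ∫ x : Fin n → ℝ, eval x P *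
      Real.exp (-eval x (quadP K + (quadP (Sig ε) + ε • quarP v))) = 0)
    (hP : ∫ x : Fin n → ℝ, eval x P * Real.exp (-eval x (quadP K)) = 0) :
    (∫ x : Fin n → ℝ, eval x (P * (quadP S1 + quarP v)) * Real.exp (-eval x (quadP K)) = 0) ∧
    (∫ x : Fin n → ℝ, eval x (P * ((1/2 : ℝ) • (quadP S1 + quarP v) ^ 2 - quadP S2)) *
      Real.exp (-eval x (quadP K)) = 0) := by
  obtain ⟨M, hM⟩ : ∃ M : ℝ, ∀ a b, |S1 a b| ≤ M := by
    refine ⟨∑ a, ∑ b, |S1 a b|, fun a b => ?_⟩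
    refine le_trans ?_ (Finset.single_le_sum (f := fun a => ∑ b, |S1 a b|) (fun i _ => Finset.sum_nonneg fun j _ => abs_nonneg _) (Finset.mem_univ a))
    exact Finset.single_le_sum (f := fun b => |S1 a b|) (fun i _ => abs_nonneg _) (Finset.mem_univ b)
  set M' := |M| + |c0| with hM'
  have hM'0 : 0 ≤ M' := by positivity
  have hpos : ∀ᶠ ε : ℝ in 𝓝[>] 0, 0 < ε := eventually_mem_nhdsWithin
  have hlt1 : ∀ᶠ ε : ℝ in 𝓝[>] 0, ε < 1 := nhdsWithin_le_nhds (gt_mem_nhds one_pos)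
  have hltk : ∀ᶠ ε : ℝ in 𝓝[>] 0, ε * M' * n < κ / 2 := by
    have : Tendsto (fun ε : ℝ => ε * M' * n) (𝓝[>] 0) (𝓝 (0 * M' * n)) :=
      ((tendsto_id.mono_left nhdsWithin_le_nhds).mul_const _).mul_const _
    rw [zero_mul, zero_mul] at this
    exact this.eventually (gt_mem_nhds (by positivity))
  have hSM : ∀ᶠ ε in 𝓝[>] (0:ℝ), ∀ a b, |Sig ε a b| ≤ ε * M' := by
    filter_upwards [hs1, hpos, hlt1] with ε h1 h2 h3 a b
    have e1 := h1 a b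
    have e2 : |ε * S1 a b| ≤ ε * |M| := by
      rw [abs_mul, abs_of_pos h2]; exact mul_le_mul_of_nonneg_left ((hM a b).trans (le_abs_self _)) h2.le
    have e3 : c0 * ε ^ 2 ≤ ε * |c0| := by
      have : ε ^ 2 ≤ ε := by nlinarith
      calc c0 * ε ^ 2 ≤ |c0| * ε ^ 2 := by gcongr; exact le_abs_self _
        _ ≤ |c0| * ε := by gcongr
        _ = _ := by ring
    calc |Sig ε a b| = |(Sig ε a b - ε * S1 a b) + ε * S1 a b| := by ring_nf
      _ ≤ _ := abs_add_le _ _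
      _ ≤ ε * M' := by rw [hM']; linarith
  set W1 := quadP S1 + quarP v with hW1
  let Wf : ℝ → MvPolynomial (Fin n) ℝ := fun ε => quadP (Sig ε) + ε • quarP v
  have hWd : ∀ ε x, eval x (Wf ε) - ε * eval x W1 = eval x (quadP fun a b => Sig ε a b - ε * S1 a b) := by
    intro ε x
    simp only [Wf, hW1, map_add, smul_eval, ev_quad, sub_mul, Finset.sum_sub_distrib, mul_assoc, ← Finset.mul_sum]
    ring
  let f : ℝ → (Fin n → ℝ) → ℝ := fun ε x =>
    eval x P * Real.exp (-eval x (quadP K)) * ((Real.exp (-eval x (Wf ε)) - 1 + ε * eval x W1) / ε ^ 2)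
  let B : MvPolynomial (Fin n) ℝ := ((M' * n) • QP n + quarP v) ^ 2 + (|c0| * n) • QP n
  have hBe : ∀ x, eval x B = (M' * n * Qf x + eval x (quarP v)) ^ 2 + |c0| * n * Qf x := by
    intro x; simp [B, smul_eval, ev_QP]
  have hlim : Tendsto (fun ε => ∫ x, f ε x) (𝓝[>] 0)
      (𝓝 (∫ x, eval x P * Real.exp (-eval x (quadP K)) * (1/2 * (eval x W1) ^ 2 - eval x (quadP S2)))) := by
    refine tendsto_integral_filter_of_dominated_convergence
      (fun x => ‖eval x (P * B) * Real.exp (-(κ/2) * Qf x)‖) ?_ ?_ ?_ ?_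
    · refine Eventually.of_forall fun ε => Continuous.aestronglyMeasurable ?_
      have h1 := ev_cont P
      have h2 := ev_cont (quadP K)
      have h3 := ev_cont (Wf ε)
      have h4 := ev_cont W1
      simp only [f]
      fun_prop
    · filter_upwards [hs1, hpos, hltk, hSM] with ε h1 h2 h3 h4
      refine Eventually.of_forall fun x => ?_
      have hQ := Qf_nonneg x
      have q1 := quad_bound (Sig ε) h4 x
      have q2 := quad_bound (fun a b => Sig ε a b - ε * S1 a b) h1 x
      rw [← hWd] at q2
      have hWe : eval x (Wf ε) = eval x (quadP (Sig ε)) + ε * eval x (quarP v) := by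
        simp [Wf, smul_eval]
      have hv' : 0 ≤ ε * eval x (quarP v) := mul_nonneg h2.le (hv x)
      have b1 : |eval x (Wf ε)| ≤ ε * (M' * n * Qf x + eval x (quarP v)) := by
        rw [hWe]
        refine (abs_add_le _ _).trans ?_
        rw [abs_of_nonneg hv']
        linarith
      have b2 : -eval x (Wf ε) ≤ κ / 2 * Qf x := by
        have := (abs_le.1 q1).1
        have : ε * M' * n * Qf x ≤ κ / 2 * Qf x := by gcongr
        linarith
      have b3 := exp_rem (-eval x (Wf ε)) (d := κ / 2 * Qf x) (by positivity) b2
      have b4 : (-eval x (Wf ε)) ^ 2 ≤ ε ^ 2 * (M' * n * Qf x + eval x (quarP v)) ^ 2 := by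
        rw [neg_sq, ← sq_abs, ← mul_pow]; gcongr
      have hexp1 : 1 ≤ Real.exp (κ / 2 * Qf x) := Real.one_le_exp (by positivity)
      have b5 : |Real.exp (-eval x (Wf ε)) - 1 + ε * eval x W1| ≤ ε ^ 2 * eval x B * Real.exp (κ / 2 * Qf x) := by
        have e : Real.exp (-eval x (Wf ε)) - 1 + ε * eval x W1 =
          (Real.exp (-eval x (Wf ε)) - 1 - (-eval x (Wf ε))) + -(eval x (Wf ε) - ε * eval x W1) := by ring
        rw [e]
        refine (abs_add_le _ _).trans ?_
        rw [abs_neg, hBe]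
        have e1 : c0 * ε ^ 2 * n * Qf x ≤ ε ^ 2 * (|c0| * n * Qf x) * Real.exp (κ / 2 * Qf x) := by
          calc c0 * ε ^ 2 * n * Qf x ≤ |c0| * ε ^ 2 * n * Qf x := by gcongr; exact le_abs_self _
            _ = ε ^ 2 * (|c0| * n * Qf x) * 1 := by ring
            _ ≤ _ := by gcongr
        have e2 := mul_le_mul_of_nonneg_right b4 (Real.exp_pos (κ / 2 * Qf x)).le
        calc _ ≤ (-eval x (Wf ε)) ^ 2 * Real.exp (κ / 2 * Qf x) + c0 * ε ^ 2 * n * Qf x := add_le_add b3 q2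
          _ ≤ _ := by linarith
      have hB0 : 0 ≤ eval x B := by rw [hBe]; positivity
      simp only [f, norm_mul, norm_div, Real.norm_eq_abs, map_mul, abs_mul, Real.abs_exp, abs_of_nonneg hB0]
      rw [abs_of_pos (by positivity : 0 < ε ^ 2), mul_assoc, mul_assoc]
      have b6 : |Real.exp (-eval x (Wf ε)) - 1 + ε * eval x W1| / ε ^ 2 ≤ eval x B * Real.exp (κ / 2 * Qf x) := by
        rw [div_le_iff₀ (by positivity)]; linarith
      have b7 : Real.exp (-eval x (quadP K)) * (|Real.exp (-eval x (Wf ε)) - 1 + ε * eval x W1| / ε ^ 2)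
          ≤ eval x B * Real.exp (-(κ / 2) * Qf x) := by
        have b8 := mul_le_mul (Real.exp_le_exp.2 (neg_le_neg (hq x))) b6 (by positivity) (Real.exp_pos _).le
        refine b8.trans (le_of_eq ?_)
        calc _ = eval x B * (Real.exp (-(κ * Qf x)) * Real.exp (κ / 2 * Qf x)) := by ring
          _ = eval x B * Real.exp (-(κ / 2) * Qf x) := by rw [← Real.exp_add]; ring_nf
      exact mul_le_mul_of_nonneg_left b7 (abs_nonneg _)
    · exact (int_poly0 (P * B) (by positivity)).norm
    · refine Eventually.of_forall fun x => ?_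
      refine Tendsto.const_mul _ (exp_lim ?_)
      simp only [hWd, ev_quad]
      have : Tendsto (fun ε => 1/2 * ∑ a, ∑ b, ((Sig ε a b - ε * S1 a b) / ε ^ 2) * (x a * x b)) (𝓝[>] 0)
          (𝓝 (1/2 * ∑ a, ∑ b, S2 a b * (x a * x b))) :=
        Tendsto.const_mul _ (tendsto_finset_sum _ fun a _ => tendsto_finset_sum _ fun b _ => (hs2 a b).mul_const _)
      refine this.congr fun ε => ?_
      simp only [mul_div_assoc, Finset.sum_div]
      congr 1
      refine Finset.sum_congr rfl fun a _ => Finset.sum_congr rfl fun b _ => ?_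
      ring
  set c := ∫ x : Fin n → ℝ, eval x (P * W1) * Real.exp (-eval x (quadP K)) with hc
  have hval : ∀ᶠ ε in 𝓝[>] (0:ℝ), ∫ x, f ε x = ε⁻¹ * c := by
    filter_upwards [hz, hpos, hltk, hSM] with ε h1 h2 h3 h4
    have i1 := int_gibbs P (quadP K + Wf ε) (κ := κ / 2) (by positivity) (by
      intro x
      have q1 := (abs_le.1 (quad_bound (Sig ε) h4 x)).1
      have hv' : 0 ≤ ε * eval x (quarP v) := mul_nonneg h2.le (hv x)
      have : ε * M' * n * Qf x ≤ κ / 2 * Qf x := by have := Qf_nonneg x; gcongr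
      simp only [Wf, map_add, smul_eval]
      linarith [hq x])
    have i2 := int_gibbs P (quadP K) hκ hq
    have i3 := int_gibbs (P * W1) (quadP K) hκ hq
    have e : ∀ x, f ε x = (ε ^ 2)⁻¹ * ((eval x P * Real.exp (-eval x (quadP K + Wf ε)) -
        eval x P * Real.exp (-eval x (quadP K))) + ε * (eval x (P * W1) * Real.exp (-eval x (quadP K)))) := by
      intro x
      simp only [f, map_add, map_mul, neg_add, Real.exp_add]
      field_simp
    simp only [e]
    have i12 : Integrable (fun x => eval x P * Real.exp (-eval x (quadP K + Wf ε)) -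
        eval x P * Real.exp (-eval x (quadP K))) := i1.sub i2
    have h1' : ∫ x : Fin n → ℝ, eval x P * Real.exp (-eval x (quadP K + Wf ε)) = 0 := h1
    rw [integral_const_mul, integral_add i12 (i3.const_mul ε), integral_sub i1 i2, integral_const_mul, hP, h1', ← hc]
    field_simp; ring
  have hlim2 := hlim.congr' hval
  have hc0 : c = 0 := by
    have h1 : Tendsto (fun ε : ℝ => ε * (ε⁻¹ * c)) (𝓝[>] 0) (𝓝 (0 * _)) :=
      (tendsto_id.mono_left nhdsWithin_le_nhds).mul hlim2
    rw [zero_mul] at h1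
    have h2 : Tendsto (fun ε : ℝ => ε * (ε⁻¹ * c)) (𝓝[>] 0) (𝓝 c) := by
      refine tendsto_const_nhds.congr' ?_
      filter_upwards [hpos] with ε h
      field_simp
    exact tendsto_nhds_unique h2 h1
  refine ⟨hc0, ?_⟩
  rw [hc0] at hlim2
  simp only [mul_zero] at hlim2
  have := tendsto_nhds_unique hlim2 tendsto_const_nhds
  rw [← this]
  refine integral_congr_ae (Eventually.of_forall fun x => ?_)
  simp only [map_mul, map_sub, smul_eval, map_pow]
  ring

end Analysis2

section Var
open MvPolynomial

theorem good_int {n : ℕ} {ρ : (Fin n → ℝ) → ℝ} (h : IsGoodDensity ρ) : Integrable ρ := by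
  by_contra hc
  have := integral_undef hc
  rw [h.2.2.1] at this
  exact one_ne_zero this

theorem quad_rho {n : ℕ} (B : Fin n → Fin n → ℝ) {ρ : (Fin n → ℝ) → ℝ} (h : IsGoodDensity ρ) :
    Integrable (fun x => eval x (quadP B) * ρ x) ∧
    ∫ x, eval x (quadP B) * ρ x = (1/2) * ∑ a, ∑ b, B a b * momMatrix ρ a b := by
  have e : (fun x : Fin n → ℝ => eval x (quadP B) * ρ x) =
      fun x => (1/2) * ∑ a, ∑ b, B a b * (x a * x b * ρ x) := by
    funext x
    rw [ev_quad, mul_assoc, Finset.sum_mul]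
    congr 1
    refine Finset.sum_congr rfl fun a _ => ?_
    rw [Finset.sum_mul]
    exact Finset.sum_congr rfl fun b _ => by ring
  have hi : ∀ a b, Integrable (fun x : Fin n → ℝ => B a b * (x a * x b * ρ x)) :=
    fun a b => (h.2.2.2.1 a b).const_mul _
  rw [e]
  constructor
  · exact (integrable_finset_sum _ fun a _ => integrable_finset_sum _ fun b _ => hi a b).const_mul _
  · rw [integral_const_mul, integral_finset_sum _ fun a _ => integrable_finset_sum _ fun b _ => hi a b]
    congr 1
    refine Finset.sum_congr rfl fun a _ => ?_
    rw [integral_finset_sum _ fun b _ => hi a b]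
    refine Finset.sum_congr rfl fun b _ => ?_
    rw [integral_const_mul]; rfl

theorem gibbs_ineq {n : ℕ} (B : Fin n → Fin n → ℝ) (pu : MvPolynomial (Fin n) ℝ) {κ : ℝ} (hκ : 0 < κ)
    (hq : ∀ x : Fin n → ℝ, κ * Qf x ≤ eval x (quadP B + pu)) {ρ : (Fin n → ℝ) → ℝ} (h : IsGoodDensity ρ)
    (hu : Integrable fun x => eval x pu * ρ x) :
    entropy ρ - ∫ x, eval x pu * ρ x ≤ Real.log (∫ x : Fin n → ℝ, Real.exp (-eval x (quadP B + pu))) +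
      (1/2) * ∑ a, ∑ b, B a b * momMatrix ρ a b := by
  have hZ := gZ_pos _ hκ hq
  set Z := ∫ x : Fin n → ℝ, Real.exp (-eval x (quadP B + pu)) with hZd
  obtain ⟨q1, q2⟩ := quad_rho B h
  have hρ := good_int h
  have hg : Integrable (fun x : Fin n → ℝ => Real.exp (-eval x (quadP B + pu))) := by
    have := int_gibbs 1 _ hκ hq
    simpa using this
  rw [← q2]
  have hpt : ∀ x, ρ x - Z⁻¹ * Real.exp (-eval x (quadP B + pu)) ≤
      ρ x * Real.log (ρ x) + eval x (quadP B) * ρ x + eval x pu * ρ x + Real.log Z * ρ x := by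
    intro x
    rcases (h.2.1 x).eq_or_lt with h0 | h0
    · rw [← h0]; simp; positivity
    · have hgp : 0 < Z⁻¹ * Real.exp (-eval x (quadP B + pu)) := by positivity
      have h1 := Real.log_le_sub_one_of_pos (div_pos hgp h0)
      rw [Real.log_div hgp.ne' h0.ne', Real.log_mul (by positivity) (by positivity), Real.log_exp, Real.log_inv] at h1
      have h2 := mul_le_mul_of_nonneg_left h1 h0.le
      have h3 : ρ x * (Z⁻¹ * Real.exp (-eval x (quadP B + pu)) / ρ x - 1) =
        Z⁻¹ * Real.exp (-eval x (quadP B + pu)) - ρ x := by field_simp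
      rw [h3, map_add] at h2
      rw [map_add]
      linarith
  have i1 : Integrable (fun x => ρ x * Real.log (ρ x) + eval x (quadP B) * ρ x) := h.2.2.2.2.add q1
  have i2 : Integrable (fun x => ρ x * Real.log (ρ x) + eval x (quadP B) * ρ x + eval x pu * ρ x) := i1.add hu
  have i3 : Integrable (fun x => Real.log Z * ρ x) := hρ.const_mul _
  have hm := integral_mono (hρ.sub (hg.const_mul Z⁻¹)) (i2.add i3) hpt
  simp only [Pi.add_apply, Pi.sub_apply] at hm
  rw [integral_sub hρ (hg.const_mul Z⁻¹), integral_add i2 i3, integral_add i1 hu, integral_add h.2.2.2.2 q1,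
    integral_const_mul, integral_const_mul, h.2.2.1, ← hZd, inv_mul_cancel₀ hZ.ne'] at hm
  unfold entropy
  linarith

theorem gibbs_dens {n : ℕ} (B : Fin n → Fin n → ℝ) (pu : MvPolynomial (Fin n) ℝ) {κ : ℝ} (hκ : 0 < κ)
    (hq : ∀ x : Fin n → ℝ, κ * Qf x ≤ eval x (quadP B + pu)) (pv : MvPolynomial (Fin n) ℝ) :
    ∃ ρ : (Fin n → ℝ) → ℝ, IsGoodDensity ρ ∧ (Integrable fun x => eval x pv * ρ x) ∧
      (∀ i j, momMatrix ρ i j = gE _ hκ hq (X i * X j)) ∧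
      entropy ρ - ∫ x, eval x pu * ρ x = Real.log (∫ x : Fin n → ℝ, Real.exp (-eval x (quadP B + pu))) +
      (1/2) * ∑ a, ∑ b, B a b * momMatrix ρ a b := by
  have hZ := gZ_pos _ hκ hq
  set Z := ∫ x : Fin n → ℝ, Real.exp (-eval x (quadP B + pu)) with hZd
  have hint : ∀ p : MvPolynomial (Fin n) ℝ, Integrable
      (fun x : Fin n → ℝ => eval x p * (Z⁻¹ * Real.exp (-eval x (quadP B + pu)))) := by
    intro p
    refine ((int_gibbs p _ hκ hq).const_mul Z⁻¹).congr (Eventually.of_forall fun x => ?_)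
    simp only; ring
  have hlog : ∀ x : Fin n → ℝ, (Z⁻¹ * Real.exp (-eval x (quadP B + pu))) * Real.log (Z⁻¹ * Real.exp (-eval x (quadP B + pu))) =
      -(eval x (quadP B) * (Z⁻¹ * Real.exp (-eval x (quadP B + pu))) + eval x pu * (Z⁻¹ * Real.exp (-eval x (quadP B + pu)))
        + Real.log Z * (Z⁻¹ * Real.exp (-eval x (quadP B + pu)))) := by
    intro x
    rw [Real.log_mul (by positivity) (by positivity), Real.log_exp, Real.log_inv, map_add]
    ring
  have i0 := hint 1
  simp only [map_one, one_mul] at i0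
  have i1 : Integrable (fun x : Fin n → ℝ => eval x (quadP B) * (Z⁻¹ * Real.exp (-eval x (quadP B + pu))) + eval x pu * (Z⁻¹ * Real.exp (-eval x (quadP B + pu)))) :=
    (hint _).add (hint _)
  have hgood : IsGoodDensity (fun x : Fin n → ℝ => Z⁻¹ * Real.exp (-eval x (quadP B + pu))) := by
    refine ⟨?_, fun x => by positivity, ?_, fun i j => ?_, ?_⟩
    · have := ev_cont (quadP B + pu)
      exact Continuous.measurable (by fun_prop)
    · rw [integral_const_mul, ← hZd, inv_mul_cancel₀ hZ.ne']
    · have := hint (X i * X j)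
      simpa using this
    · simp only [hlog]
      exact (i1.add (i0.const_mul _)).neg
  refine ⟨_, hgood, hint pv, fun i j => ?_, ?_⟩
  · simp only [momMatrix, gE, LinearMap.coe_mk, AddHom.coe_mk, Matrix.of_apply, ← hZd]
    rw [← integral_const_mul]
    congr 1; funext x
    simp only [map_mul, eval_X]; ring
  · rw [← (quad_rho B hgood).2]
    unfold entropy
    simp only [hlog]
    rw [integral_neg, integral_add i1 (i0.const_mul _), integral_add (hint _) (hint _), integral_const_mul, hgood.2.2.1]
    ring

theorem mix {n : ℕ} {ρ σ V : (Fin n → ℝ) → ℝ} (hρ : IsGoodDensity ρ) (hσ : IsGoodDensity σ)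
    (iρ : Integrable fun x => V x * ρ x) (iσ : Integrable fun x => V x * σ x) {t : ℝ} (ht0 : 0 < t) (ht1 : t < 1) :
    ∃ τ : (Fin n → ℝ) → ℝ, IsGoodDensity τ ∧ (Integrable fun x => V x * τ x) ∧
      momMatrix τ = (1 - t) • momMatrix ρ + t • momMatrix σ ∧
      (1 - t) * (entropy ρ - ∫ x, V x * ρ x) + t * (entropy σ - ∫ x, V x * σ x) ≤ entropy τ - ∫ x, V x * τ x := by
  have ht2 : 0 < 1 - t := by linarith
  have jρ := good_int hρ
  have jσ := good_int hσ
  have eV : ∀ x, V x * ((1 - t) * ρ x + t * σ x) = (1 - t) * (V x * ρ x) + t * (V x * σ x) := fun x => by ring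
  have eM : ∀ i j (x : Fin n → ℝ), x i * x j * ((1 - t) * ρ x + t * σ x) = (1 - t) * (x i * x j * ρ x) + t * (x i * x j * σ x) :=
    fun i j x => by ring
  have hub : ∀ x, ((1 - t) * ρ x + t * σ x) * Real.log ((1 - t) * ρ x + t * σ x) ≤
      (1 - t) * (ρ x * Real.log (ρ x)) + t * (σ x * Real.log (σ x)) := by
    intro x
    have := Real.convexOn_mul_log.2 (hρ.2.1 x) (hσ.2.1 x) ht2.le ht0.le (by ring)
    simpa only [smul_eq_mul] using this
  have aux : ∀ a b : ℝ, 0 ≤ a → 0 ≤ b → a * Real.log a ≤ a * Real.log (a + b) := by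
    intro a b ha hb
    rcases ha.eq_or_lt with h | h
    · rw [← h]; simp
    · exact mul_le_mul_of_nonneg_left (Real.log_le_log h (by linarith)) ha
  have aux2 : ∀ c a : ℝ, 0 < c → 0 ≤ a → (c * a) * Real.log (c * a) = c * Real.log c * a + c * (a * Real.log a) := by
    intro c a hc ha
    rcases ha.eq_or_lt with h | h
    · rw [← h]; simp
    · rw [Real.log_mul hc.ne' h.ne']; ring
  have hlb : ∀ x, ((1 - t) * Real.log (1 - t) * ρ x + (1 - t) * (ρ x * Real.log (ρ x))) +
      (t * Real.log t * σ x + t * (σ x * Real.log (σ x))) ≤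
      ((1 - t) * ρ x + t * σ x) * Real.log ((1 - t) * ρ x + t * σ x) := by
    intro x
    have p1 : 0 ≤ (1 - t) * ρ x := mul_nonneg ht2.le (hρ.2.1 x)
    have p2 : 0 ≤ t * σ x := mul_nonneg ht0.le (hσ.2.1 x)
    have a1 := aux _ _ p1 p2
    have a2 := aux _ _ p2 p1
    rw [aux2 _ _ ht2 (hρ.2.1 x)] at a1
    rw [aux2 _ _ ht0 (hσ.2.1 x), add_comm (t * σ x)] at a2
    linarith
  have hmeas : Measurable fun x => (1 - t) * ρ x + t * σ x := (hρ.1.const_mul _).add (hσ.1.const_mul _)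
  have iub : Integrable (fun x => (1 - t) * (ρ x * Real.log (ρ x)) + t * (σ x * Real.log (σ x))) :=
    (hρ.2.2.2.2.const_mul _).add (hσ.2.2.2.2.const_mul _)
  have ilb : Integrable (fun x => ((1 - t) * Real.log (1 - t) * ρ x + (1 - t) * (ρ x * Real.log (ρ x))) +
      (t * Real.log t * σ x + t * (σ x * Real.log (σ x)))) :=
    ((jρ.const_mul _).add (hρ.2.2.2.2.const_mul _)).add ((jσ.const_mul _).add (hσ.2.2.2.2.const_mul _))
  have iτ : Integrable (fun x => ((1 - t) * ρ x + t * σ x) * Real.log ((1 - t) * ρ x + t * σ x)) := by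
    refine (iub.norm.add ilb.norm).mono' (hmeas.mul hmeas.log).aestronglyMeasurable (Eventually.of_forall fun x => ?_)
    simp only [Pi.add_apply, Real.norm_eq_abs]
    rw [abs_le]
    constructor
    · have := neg_abs_le (((1 - t) * Real.log (1 - t) * ρ x + (1 - t) * (ρ x * Real.log (ρ x))) +
        (t * Real.log t * σ x + t * (σ x * Real.log (σ x))))
      have h2 := abs_nonneg ((1 - t) * (ρ x * Real.log (ρ x)) + t * (σ x * Real.log (σ x)))
      linarith [hlb x]
    · have := le_abs_self ((1 - t) * (ρ x * Real.log (ρ x)) + t * (σ x * Real.log (σ x)))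
      have h2 := abs_nonneg (((1 - t) * Real.log (1 - t) * ρ x + (1 - t) * (ρ x * Real.log (ρ x))) +
        (t * Real.log t * σ x + t * (σ x * Real.log (σ x))))
      linarith [hub x]
  refine ⟨fun x => (1 - t) * ρ x + t * σ x, ⟨hmeas, fun x => ?_, ?_, fun i j => ?_, iτ⟩, ?_, ?_, ?_⟩
  · exact add_nonneg (mul_nonneg ht2.le (hρ.2.1 x)) (mul_nonneg ht0.le (hσ.2.1 x))
  · rw [integral_add (jρ.const_mul _) (jσ.const_mul _), integral_const_mul, integral_const_mul, hρ.2.2.1, hσ.2.2.1]; ring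
  · simp only [eM]
    exact ((hρ.2.2.2.1 i j).const_mul _).add ((hσ.2.2.2.1 i j).const_mul _)
  · simp only [eV]
    exact (iρ.const_mul _).add (iσ.const_mul _)
  · ext i j
    simp only [momMatrix, Matrix.of_apply, Matrix.add_apply, Matrix.smul_apply, smul_eq_mul, eM]
    rw [integral_add ((hρ.2.2.2.1 i j).const_mul _) ((hσ.2.2.2.1 i j).const_mul _), integral_const_mul, integral_const_mul]
  · simp only [eV]
    rw [integral_add (iρ.const_mul _) (iσ.const_mul _), integral_const_mul, integral_const_mul]
    have hm := integral_mono iτ iub hub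
    rw [integral_add (hρ.2.2.2.2.const_mul _) (hσ.2.2.2.2.const_mul _), integral_const_mul, integral_const_mul] at hm
    unfold entropy
    linarith

end Var

section Var2
open MvPolynomial

theorem le_F {n : ℕ} (B : Fin n → Fin n → ℝ) (pu : MvPolynomial (Fin n) ℝ) {κ : ℝ} (hκ : 0 < κ)
    (hq : ∀ x : Fin n → ℝ, κ * Qf x ≤ eval x (quadP B + pu)) {ρ : (Fin n → ℝ) → ℝ} (h : IsGoodDensity ρ)
    (hu : Integrable fun x => eval x pu * ρ x) :
    entropy ρ - ∫ x, eval x pu * ρ x ≤ Ffun n (fun x => eval x pu) (momMatrix ρ) := by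
  refine le_csSup ⟨Real.log (∫ x : Fin n → ℝ, Real.exp (-eval x (quadP B + pu))) +
      (1/2) * ∑ a, ∑ b, B a b * momMatrix ρ a b, ?_⟩ ⟨ρ, h, hu, rfl, rfl⟩
  rintro r ⟨σ, h1, h2, h3, rfl⟩
  rw [← h3]
  exact gibbs_ineq B pu hκ hq h1 h2

theorem F_le {n : ℕ} (B : Fin n → Fin n → ℝ) (pu : MvPolynomial (Fin n) ℝ) {κ : ℝ} (hκ : 0 < κ)
    (hq : ∀ x : Fin n → ℝ, κ * Qf x ≤ eval x (quadP B + pu)) {G : Matrix (Fin n) (Fin n) ℝ}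
    (hne : ∃ ρ : (Fin n → ℝ) → ℝ, IsGoodDensity ρ ∧ (Integrable fun x => eval x pu * ρ x) ∧ momMatrix ρ = G) :
    Ffun n (fun x => eval x pu) G ≤ Real.log (∫ x : Fin n → ℝ, Real.exp (-eval x (quadP B + pu))) +
      (1/2) * ∑ a, ∑ b, B a b * G a b := by
  obtain ⟨ρ, h1, h2, h3⟩ := hne
  refine csSup_le ⟨_, ρ, h1, h2, h3, rfl⟩ ?_
  rintro r ⟨σ, k1, k2, k3, rfl⟩
  rw [← k3]
  exact gibbs_ineq B pu hκ hq k1 k2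

theorem F_mix {n : ℕ} (A : Fin n → Fin n → ℝ) (pu : MvPolynomial (Fin n) ℝ) {κ : ℝ} (hκ : 0 < κ)
    (hq : ∀ x : Fin n → ℝ, κ * Qf x ≤ eval x (quadP A + pu)) {G : Matrix (Fin n) (Fin n) ℝ}
    (hne : ∃ ρ : (Fin n → ℝ) → ℝ, IsGoodDensity ρ ∧ (Integrable fun x => eval x pu * ρ x) ∧ momMatrix ρ = G)
    {σ : (Fin n → ℝ) → ℝ} (hσ : IsGoodDensity σ) (iσ : Integrable fun x => eval x pu * σ x)
    {t : ℝ} (ht0 : 0 < t) (ht1 : t < 1) :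
    (1 - t) * Ffun n (fun x => eval x pu) G + t * (entropy σ - ∫ x, eval x pu * σ x) ≤
      Ffun n (fun x => eval x pu) (G + t • (momMatrix σ - G)) := by
  have ht2 : 0 < 1 - t := by linarith
  have : Ffun n (fun x => eval x pu) G ≤ (Ffun n (fun x => eval x pu) (G + t • (momMatrix σ - G)) -
      t * (entropy σ - ∫ x, eval x pu * σ x)) / (1 - t) := by
    obtain ⟨ρ, h1, h2, h3⟩ := hne
    refine csSup_le ⟨_, ρ, h1, h2, h3, rfl⟩ ?_
    rintro r ⟨ρ', k1, k2, k3, rfl⟩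
    obtain ⟨τ, t1, t2, t3, t4⟩ := mix k1 hσ k2 iσ ht0 ht1
    have h5 := le_F A pu hκ hq t1 t2
    rw [t3, k3] at h5
    have e : (1 - t) • G + t • momMatrix σ = G + t • (momMatrix σ - G) := by module
    rw [e] at h5
    rw [le_div_iff₀ ht2]
    linarith
  rw [le_div_iff₀ ht2] at this
  linarith

theorem logdet_deriv {n : ℕ} (G K H : Matrix (Fin n) (Fin n) ℝ) (hG : 0 < G.det) (hGK : G * K = 1) :
    HasDerivAt (fun t : ℝ => Real.log (G + t • H).det) ((K * H).trace) 0 := by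
  have e : ∀ t : ℝ, (G + t • H).det = G.det * (1 + t • (K * H)).det := by
    intro t
    rw [← Matrix.det_mul]
    congr 1
    rw [mul_add, mul_one, Matrix.mul_smul, ← Matrix.mul_assoc, hGK, Matrix.one_mul]
  have h1 : HasDerivAt (fun t : ℝ => (1 + t • (K * H)).det) ((K * H).trace) 0 := by
    let p := (Matrix.det (1 + (Polynomial.X : Polynomial ℝ) • (K * H).map Polynomial.C)).divX.divX
    have a1 : HasDerivAt (fun t : ℝ => 1 + (K * H).trace * t) ((K * H).trace) 0 := by
      simpa using ((hasDerivAt_id (0:ℝ)).const_mul ((K * H).trace)).const_add 1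
    have a2 := (p.hasDerivAt 0).mul ((hasDerivAt_id (0:ℝ)).pow 2)
    refine ((a1.add a2).congr_deriv ?_).congr_of_eventuallyEq (Eventually.of_forall fun t => ?_)
    · simp
    · exact Matrix.det_one_add_smul t (K * H)
  have h2 := (h1.const_mul G.det).log (by simp [hG.ne'])
  refine (h2.congr_deriv ?_).congr_of_eventuallyEq (Eventually.of_forall fun t => ?_)
  · simp; field_simp
  · simp only [e]

theorem F_ge {n : ℕ} (Sg G K : Matrix (Fin n) (Fin n) ℝ) (pu : MvPolynomial (Fin n) ℝ) {κ : ℝ} (hκ : 0 < κ)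
    (hq : ∀ x : Fin n → ℝ, κ * Qf x ≤ eval x (quadP (K + Sg) + pu))
    (hGd : 0 < G.det) (hGK : G * K = 1) (hGs : G.IsSymm)
    (hne : ∃ ρ : (Fin n → ℝ) → ℝ, IsGoodDensity ρ ∧ (Integrable fun x => eval x pu * ρ x) ∧ momMatrix ρ = G)
    (hD : HasFDerivWithinAt (Phi n (fun x => eval x pu)) (tracePairing Sg)
        {M : Matrix (Fin n) (Fin n) ℝ | M.IsSymm} G) :
    Real.log (∫ x : Fin n → ℝ, Real.exp (-eval x (quadP (K + Sg) + pu))) +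
      (1/2) * ∑ a, ∑ b, (K + Sg) a b * G a b ≤ Ffun n (fun x => eval x pu) G := by
  obtain ⟨σ, s1, s2, -, s4⟩ := gibbs_dens (K + Sg) pu hκ hq pu
  set H := momMatrix σ - G with hH
  have hHs : H.IsSymm := by
    refine Matrix.IsSymm.sub ?_ hGs
    ext i j
    simp only [momMatrix, Matrix.transpose_apply, Matrix.of_apply]
    congr 1; funext x; ring
  have hline : HasDerivWithinAt (fun t : ℝ => G + t • H) H (Set.Ioi 0) 0 := by
    have := ((hasDerivAt_id (0:ℝ)).smul_const H).const_add G
    rw [one_smul] at this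
    exact this.hasDerivWithinAt
  have hD0 : HasFDerivWithinAt (Phi n (fun x => eval x pu)) (tracePairing Sg)
        {M : Matrix (Fin n) (Fin n) ℝ | M.IsSymm} (G + (0:ℝ) • H) := by simpa using hD
  have hd1 := hD0.comp_hasDerivWithinAt (0:ℝ) hline (fun t _ => by
    show (G + t • H).IsSymm
    exact hGs.add (hHs.smul t))
  have hd2 := (logdet_deriv G K H hGd hGK).hasDerivWithinAt (s := Set.Ioi 0)
  have hd3 : HasDerivWithinAt (fun t : ℝ => Ffun n (fun x => eval x pu) (G + t • H))
      ((1/2) * ((Sg * H).trace + (K * H).trace)) (Set.Ioi 0) 0 := by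
    have := ((hd1.add hd2).add_const ((n : ℝ) * Real.log (2 * π * Real.exp 1))).const_mul (1/2)
    refine HasDerivWithinAt.congr_of_eventuallyEq this (Eventually.of_forall fun t => ?_) ?_
    · simp only [Function.comp, Phi, Pi.add_apply]; ring
    · simp only [Function.comp, Phi, Pi.add_apply]; ring
  rw [hasDerivWithinAt_iff_tendsto_slope' (by simp)] at hd3
  have hlow : (entropy σ - ∫ x, eval x pu * σ x) - Ffun n (fun x => eval x pu) G ≤ (1/2) * ((Sg * H).trace + (K * H).trace) := by
    refine ge_of_tendsto hd3 ?_
    have e0 : ∀ᶠ t : ℝ in 𝓝[>] 0, 0 < t := eventually_mem_nhdsWithin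
    have e1 : ∀ᶠ t : ℝ in 𝓝[>] 0, t < 1 := nhdsWithin_le_nhds (gt_mem_nhds one_pos)
    filter_upwards [e0, e1] with t h0 h1
    have := F_mix (K + Sg) pu hκ hq hne s1 s2 h0 h1
    rw [slope_def_field, zero_smul, add_zero, sub_zero, le_div_iff₀ h0]
    linarith
  have htr : (Sg * H).trace + (K * H).trace = ∑ a, ∑ b, (K + Sg) a b * momMatrix σ a b - ∑ a, ∑ b, (K + Sg) a b * G a b := by
    rw [← Matrix.trace_add, ← add_mul, add_comm Sg, Matrix.trace, ← Finset.sum_sub_distrib]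
    refine Finset.sum_congr rfl fun a _ => ?_
    rw [Matrix.diag_apply, Matrix.mul_apply, ← Finset.sum_sub_distrib]
    refine Finset.sum_congr rfl fun b _ => ?_
    rw [hHs.apply a b, hH, Matrix.sub_apply]; ring
  rw [htr, s4] at hlow
  linarith

theorem station {n : ℕ} (A : Fin n → Fin n → ℝ) (G : Matrix (Fin n) (Fin n) ℝ) (pu : MvPolynomial (Fin n) ℝ) {κ : ℝ} (hκ : 0 < κ)
    (hq : ∀ x : Fin n → ℝ, κ * Qf x ≤ eval x (quadP A + pu))
    (hne : ∃ ρ : (Fin n → ℝ) → ℝ, IsGoodDensity ρ ∧ (Integrable fun x => eval x pu * ρ x) ∧ momMatrix ρ = G)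
    (hF : Real.log (∫ x : Fin n → ℝ, Real.exp (-eval x (quadP A + pu))) +
      (1/2) * ∑ a, ∑ b, A a b * G a b ≤ Ffun n (fun x => eval x pu) G) (i j : Fin n) :
    ∫ x : Fin n → ℝ, eval x (X i * X j - C (G i j)) * Real.exp (-eval x (quadP A + pu)) = 0 := by
  set P : MvPolynomial (Fin n) ℝ := X i * X j - C (G i j) with hP
  have hxx : ∀ x : Fin n → ℝ, |x i * x j| ≤ Qf x := by
    intro x
    have h1 : x i ^ 2 ≤ Qf x := Finset.single_le_sum (f := fun k => x k ^ 2) (fun k _ => sq_nonneg _) (Finset.mem_univ i)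
    have h2 : x j ^ 2 ≤ Qf x := Finset.single_le_sum (f := fun k => x k ^ 2) (fun k _ => sq_nonneg _) (Finset.mem_univ j)
    rw [abs_le]; constructor <;> nlinarith [sq_nonneg (x i + x j), sq_nonneg (x i - x j)]
  have hPx : ∀ x : Fin n → ℝ, eval x P = x i * x j - G i j := by intro x; simp [hP]
  let f : ℝ → (Fin n → ℝ) → ℝ := fun s x => Real.exp (-eval x (quadP A + pu) - s * (1/2 * eval x P))
  let f' : ℝ → (Fin n → ℝ) → ℝ := fun s x => -(1/2 * eval x P) * Real.exp (-eval x (quadP A + pu) - s * (1/2 * eval x P))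
  have hder := hasDerivAt_integral_of_dominated_loc_of_deriv_le (μ := (volume : Measure (Fin n → ℝ))) (F := f) (F' := f') (x₀ := (0:ℝ))
    (s := Metric.ball 0 κ) (bound := fun x => Real.exp (κ / 2 * |G i j|) * ‖eval x P * Real.exp (-(κ / 2) * Qf x)‖)
    (Metric.ball_mem_nhds _ hκ) ?_ ?_ ?_ ?_ ?_ ?_
  rotate_left
  · refine Eventually.of_forall fun s => Continuous.aestronglyMeasurable ?_
    have h1 := ev_cont P
    have h2 := ev_cont (quadP A + pu)
    simp only [f]; fun_prop
  · have := int_gibbs 1 _ hκ hq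
    simpa [f] using this
  · refine Continuous.aestronglyMeasurable ?_
    have h1 := ev_cont P
    have h2 := ev_cont (quadP A + pu)
    simp only [f']; fun_prop
  · refine Eventually.of_forall fun x s hs => ?_
    have hs' : |s| < κ := by simpa using hs
    simp only [f', norm_mul, norm_neg, Real.norm_eq_abs, Real.abs_exp]
    have e1 : Real.exp (-eval x (quadP A + pu) - s * (1/2 * eval x P)) ≤ Real.exp (κ / 2 * |G i j|) * Real.exp (-(κ / 2) * Qf x) := by
      rw [← Real.exp_add]
      refine Real.exp_le_exp.2 ?_
      have b1 : |eval x P| ≤ Qf x + |G i j| := by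
        rw [hPx]; exact (abs_sub _ _).trans (by linarith [hxx x])
      have b2 : |s * (1/2 * eval x P)| ≤ κ * (1/2 * (Qf x + |G i j|)) := by
        rw [abs_mul, abs_mul, abs_of_pos (by norm_num : (0:ℝ) < 1/2)]
        exact mul_le_mul hs'.le (by linarith) (by positivity) hκ.le
      have b3 := (abs_le.1 b2).1
      linarith [hq x]
    have e2 : |(1/2 : ℝ)| * |eval x P| ≤ |eval x P| := by
      rw [abs_of_pos (by norm_num : (0:ℝ) < 1/2)]; linarith [abs_nonneg (eval x P)]
    calc _ ≤ |eval x P| * (Real.exp (κ / 2 * |G i j|) * Real.exp (-(κ / 2) * Qf x)) :=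
          mul_le_mul e2 e1 (Real.exp_pos _).le (abs_nonneg _)
      _ = _ := by ring
  · exact ((int_poly0 P (by positivity)).norm).const_mul _
  · refine Eventually.of_forall fun x s _ => ?_
    have h1 : HasDerivAt (fun s : ℝ => -eval x (quadP A + pu) - s * (1/2 * eval x P)) (-(1/2 * eval x P)) s := by
      simpa using ((hasDerivAt_id s).mul_const (1/2 * eval x P)).const_sub (-eval x (quadP A + pu))
    exact h1.exp.congr_deriv (by simp only [f']; ring)
  have hmin : IsLocalMin (fun s => ∫ x, f s x) 0 := by
    filter_upwards [Metric.ball_mem_nhds (0:ℝ) hκ] with s hs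
    have hs' : |s| < κ := by simpa using hs
    let B : Fin n → Fin n → ℝ := fun a b => A a b + s * (if a = i then (if b = j then 1 else 0) else 0)
    have hBx : ∀ x : Fin n → ℝ, eval x (quadP B + pu) = eval x (quadP A + pu) + s * (1/2 * (x i * x j)) := by
      intro x
      simp only [map_add, ev_quad, B, add_mul, Finset.sum_add_distrib]
      simp [mul_assoc]
      ring
    have hqB : ∀ x : Fin n → ℝ, κ / 2 * Qf x ≤ eval x (quadP B + pu) := by
      intro x
      rw [hBx]
      have b2 : |s * (1/2 * (x i * x j))| ≤ κ * (1/2 * Qf x) := by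
        rw [abs_mul, abs_mul, abs_of_pos (by norm_num : (0:ℝ) < 1/2)]
        exact mul_le_mul hs'.le (by linarith [hxx x]) (by positivity) hκ.le
      have b3 := (abs_le.1 b2).1
      linarith [hq x]
    have hZB := gZ_pos _ (by positivity) hqB
    have hZA := gZ_pos _ hκ hq
    have h1 := hF.trans (F_le B pu (by positivity) hqB hne)
    have h2 : ∑ a, ∑ b, B a b * G a b = ∑ a, ∑ b, A a b * G a b + s * G i j := by
      simp only [B, add_mul, Finset.sum_add_distrib]
      simp [mul_assoc]
    rw [h2] at h1
    have e1 : ∫ x, f s x = Real.exp (s * (1/2 * G i j)) * ∫ x : Fin n → ℝ, Real.exp (-eval x (quadP B + pu)) := by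
      rw [← integral_const_mul]
      congr 1; funext x
      rw [← Real.exp_add, hBx]
      simp only [f, hPx]
      congr 1; ring
    have e0 : ∫ x, f 0 x = ∫ x : Fin n → ℝ, Real.exp (-eval x (quadP A + pu)) := by
      simp [f]
    show ∫ x, f 0 x ≤ ∫ x, f s x
    rw [e0, e1, ← Real.log_le_log_iff hZA (by positivity), Real.log_mul (by positivity) hZB.ne', Real.log_exp]
    linarith
  have h0 := hmin.hasDerivAt_eq_zero hder.2
  have h1 : ∫ x, f' 0 x = -(1/2) * ∫ x : Fin n → ℝ, eval x P * Real.exp (-eval x (quadP A + pu)) := by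
    rw [← integral_const_mul]
    congr 1; funext x
    simp only [f', zero_mul, sub_zero]; ring
  rw [h1] at h0
  linarith

end Var2

section Fin
open MvPolynomial

theorem quar_nonneg {n : ℕ} (v : Fin n → Fin n → ℝ)
    (hU : Tendsto (fun x : Fin n → ℝ => eval x (quarP v) - 1 * ‖x‖ ^ 2) (cocompact _) atTop) (x : Fin n → ℝ) :
    0 ≤ eval x (quarP v) := by
  by_contra hc
  push Not at hc
  have hx : x ≠ 0 := by
    rintro rfl
    rw [ev_quar] at hc
    simp at hc
  have hxn : 0 < ‖x‖ := norm_pos_iff.2 hx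
  have h1 : Tendsto (fun t : ℝ => t • x) atTop (cocompact _) := by
    rw [← Metric.cobounded_eq_cocompact, ← tendsto_norm_atTop_iff_cobounded]
    refine (tendsto_id.atTop_mul_const hxn).congr' ?_
    filter_upwards [eventually_ge_atTop 0] with t ht
    rw [norm_smul, Real.norm_eq_abs, abs_of_nonneg ht]; rfl
  have h2 := (hU.comp h1).eventually (eventually_gt_atTop 0)
  obtain ⟨t, ht⟩ := h2.exists
  simp only [Function.comp] at ht
  have h3 : eval (t • x) (quarP v) = t ^ 4 * eval x (quarP v) := by
    rw [ev_quar, ev_quar]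
    simp only [Finset.mul_sum, Pi.smul_apply, smul_eq_mul]
    refine Finset.sum_congr rfl fun a _ => ?_
    refine Finset.sum_congr rfl fun b _ => ?_
    ring
  rw [h3] at ht
  have h4 : t ^ 4 * eval x (quarP v) ≤ 0 := mul_nonpos_of_nonneg_of_nonpos (by positivity) hc.le
  have h5 : 0 ≤ ‖t • x‖ ^ 2 := by positivity
  linarith

theorem quad_coer {n : ℕ} (K : Fin n → Fin n → ℝ)
    (hK : ∀ x : Fin n → ℝ, x ≠ 0 → 0 < ∑ a, ∑ b, K a b * (x a * x b)) :
    ∃ κ : ℝ, 0 < κ ∧ ∀ x : Fin n → ℝ, κ * Qf x ≤ eval x (quadP K) := by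
  have hpos : ∀ x : Fin n → ℝ, x ≠ 0 → 0 < eval x (quadP K) := by
    intro x hx
    rw [ev_quad]
    linarith [hK x hx]
  obtain ⟨m, hm, hm2⟩ := (isCompact_sphere (0 : Fin n → ℝ) 1).exists_forall_le'
    (ev_cont (quadP K)).continuousOn (a := 0) (fun b hb => hpos b (by
      rintro rfl
      simp at hb))
  refine ⟨m / (n + 1), by positivity, fun x => ?_⟩
  rcases eq_or_ne x 0 with rfl | hx
  · rw [ev_quad]; simp [Qf]
  have hxn : 0 < ‖x‖ := norm_pos_iff.2 hx
  have h1 := hm2 (‖x‖⁻¹ • x) (by simp [norm_smul, hxn.ne'])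
  have h3 : eval (‖x‖⁻¹ • x) (quadP K) = (‖x‖⁻¹) ^ 2 * eval x (quadP K) := by
    rw [ev_quad, ev_quad]
    simp only [Finset.mul_sum, Pi.smul_apply, smul_eq_mul]
    refine Finset.sum_congr rfl fun a _ => ?_
    refine Finset.sum_congr rfl fun b _ => ?_
    ring
  rw [h3] at h1
  have h4 : m * ‖x‖ ^ 2 ≤ eval x (quadP K) := by
    have := mul_le_mul_of_nonneg_right h1 (sq_nonneg ‖x‖)
    have e : (‖x‖⁻¹) ^ 2 * eval x (quadP K) * ‖x‖ ^ 2 = eval x (quadP K) := by field_simp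
    rwa [e] at this
  have h5 : Qf x ≤ (n + 1) * ‖x‖ ^ 2 := by
    have : Qf x ≤ ∑ i : Fin n, ‖x‖ ^ 2 := by
      refine Finset.sum_le_sum fun i _ => ?_
      have := norm_le_pi_norm x i
      rw [Real.norm_eq_abs] at this
      rw [← sq_abs]
      gcongr
    simp at this
    nlinarith [sq_nonneg ‖x‖]
  calc m / (n + 1) * Qf x ≤ m / (n + 1) * ((n + 1) * ‖x‖ ^ 2) := by gcongr
    _ = m * ‖x‖ ^ 2 := by field_simp
    _ ≤ _ := h4

theorem quadP_add {n : ℕ} (A B : Fin n → Fin n → ℝ) : quadP (fun a b => A a b + B a b) = quadP A + quadP B := by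
  simp only [quadP, add_smul, Finset.sum_add_distrib, smul_add]

end Fin

/-- Second-order bold self-energy coefficient: for the quartic interaction
`U(x) = (1/8) Σ_{ij} v_{ij} x_i² x_j²` with symmetric `v` and superquadratic growth and
`G ≻ 0`, the second coefficient of the asymptotic series of `ε ↦ Σ[G; εU]` is
`(Σ^(2))_{ij} = ½ G_{ij} (Σ_{kl} v_{ik} G_{kl}² v_{lj}) + Σ_{kl} v_{ik} G_{kj} G_{kl} G_{li} v_{jl}`. -/
theorem statement17 (n : ℕ) (hn : 1 ≤ n)
    (v : Matrix (Fin n) (Fin n) ℝ) (hv : v.IsSymm)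
    (U : (Fin n → ℝ) → ℝ)
    (hUdef : U = fun x => (1 / 8) * ∑ i, ∑ j, v i j * (x i) ^ 2 * (x j) ^ 2)
    (hU : SuperQuadratic U)
    (G : Matrix (Fin n) (Fin n) ℝ) (hG : G.PosDef)
    (Sig : ℝ → Matrix (Fin n) (Fin n) ℝ)
    (hSig : ∀ ε : ℝ, 0 < ε → (Sig ε).IsSymm ∧
      HasFDerivWithinAt (Phi n (fun x => ε * U x)) (tracePairing (Sig ε))
        {M : Matrix (Fin n) (Fin n) ℝ | M.IsSymm} G)
    (S : ℕ → Matrix (Fin n) (Fin n) ℝ)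
    (hSsymm : ∀ k, (S k).IsSymm)
    (hSigAsymp : ∀ N : ℕ,
      (fun ε : ℝ => Sig ε - ∑ k ∈ Finset.Icc 1 N, ε ^ k • S k)
        =O[𝓝[>] (0 : ℝ)] fun ε => ε ^ (N + 1)) :
    ∀ i j : Fin n, S 2 i j =
      (1 / 2) * G i j * (∑ k, ∑ l, v i k * (G k l) ^ 2 * v l j) +
        ∑ k, ∑ l, v i k * G k j * G k l * G l i * v j l := by
  classical
  set K := G⁻¹ with hKdef
  have hKp : K.PosDef := hG.inv
  have hdet : 0 < G.det := hG.det_pos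
  have hGK : G * K = 1 := Matrix.mul_nonsing_inv _ hdet.ne'.isUnit
  have hKG : K * G = 1 := Matrix.nonsing_inv_mul _ hdet.ne'.isUnit
  have hGs : G.IsSymm := by
    have := hG.isHermitian
    rwa [Matrix.IsHermitian, Matrix.conjTranspose_eq_transpose_of_trivial] at this
  have hKs : K.IsSymm := by
    have := hKp.isHermitian
    rwa [Matrix.IsHermitian, Matrix.conjTranspose_eq_transpose_of_trivial] at this
  have hKs' : ∀ a b, K a b = K b a := fun a b => (hKs.apply a b).symm
  have hUe : ∀ x, U x = MvPolynomial.eval x (quarP v) := by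
    intro x
    refine (congrFun hUdef x).trans (Eq.trans ?_ (ev_quar v x).symm)
    simp only [mul_assoc]
  have hqv : ∀ x : Fin n → ℝ, 0 ≤ MvPolynomial.eval x (quarP v) := by
    refine quar_nonneg v ?_
    have := hU.2 1 one_pos
    simpa only [hUe] using this
  obtain ⟨κ, hκ, hq⟩ := quad_coer K (by
    intro x hx
    have := hKp.dotProduct_mulVec_pos hx
    simp only [dotProduct, mulVec, Finset.mul_sum, star_trivial] at this
    refine this.trans_eq ?_
    exact Finset.sum_congr rfl fun a _ => Finset.sum_congr rfl fun b _ => by ring)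
  have hE1 := gE_one (quadP K) hκ hq
  have hIBP := gE_ibp G K hGK hKs' hκ hq
  have hpair := alg_pair G (gE (quadP K) hκ hq) hE1 hIBP
  have hpos : ∀ᶠ ε : ℝ in 𝓝[>] 0, 0 < ε := eventually_mem_nhdsWithin
  have hne : ∀ pu : MvPolynomial (Fin n) ℝ, ∃ ρ : (Fin n → ℝ) → ℝ, IsGoodDensity ρ ∧
      (Integrable fun x => MvPolynomial.eval x pu * ρ x) ∧ momMatrix ρ = G := by
    intro pu
    have hq0 : ∀ x : Fin n → ℝ, κ * Qf x ≤ MvPolynomial.eval x (quadP K + 0) := by simpa using hq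
    obtain ⟨ρ, r1, r2, r3, -⟩ := gibbs_dens K 0 hκ hq0 pu
    refine ⟨ρ, r1, r2, ?_⟩
    ext i j
    rw [r3, ← hpair i j]
    simp only [gE, add_zero]
  have hs0 : ∃ c : ℝ, ∀ᶠ ε in 𝓝[>] (0:ℝ), ∀ a b, |Sig ε a b| ≤ c * ε := by
    obtain ⟨c, hc⟩ := (hSigAsymp 0).bound
    refine ⟨c, ?_⟩
    filter_upwards [hc, hpos] with ε h1 h2 a b
    have h3 := (Matrix.norm_entry_le_entrywise_sup_norm _ (i := a) (j := b)).trans h1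
    simpa [abs_of_pos h2] using h3
  have hs1 : ∃ c : ℝ, ∀ᶠ ε in 𝓝[>] (0:ℝ), ∀ a b, |Sig ε a b - ε * S 1 a b| ≤ c * ε ^ 2 := by
    obtain ⟨c, hc⟩ := (hSigAsymp 1).bound
    refine ⟨c, ?_⟩
    filter_upwards [hc, hpos] with ε h1 h2 a b
    have h3 := (Matrix.norm_entry_le_entrywise_sup_norm _ (i := a) (j := b)).trans h1
    simpa [abs_of_pos h2] using h3
  have hs2 : ∀ a b, Tendsto (fun ε => (Sig ε a b - ε * S 1 a b) / ε ^ 2) (𝓝[>] 0) (𝓝 (S 2 a b)) := by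
    intro a b
    obtain ⟨c, hc⟩ := (hSigAsymp 2).bound
    rw [tendsto_iff_norm_sub_tendsto_zero]
    have hz : Tendsto (fun ε : ℝ => c * ε) (𝓝[>] 0) (𝓝 0) := by
      have : Tendsto (fun ε : ℝ => c * ε) (𝓝[>] 0) (𝓝 (c * 0)) :=
        (tendsto_id.mono_left nhdsWithin_le_nhds).const_mul c
      rwa [mul_zero] at this
    refine squeeze_zero' (Eventually.of_forall fun _ => norm_nonneg _) ?_ hz
    filter_upwards [hc, hpos] with ε h1 h2
    have h3 := (Matrix.norm_entry_le_entrywise_sup_norm _ (i := a) (j := b)).trans h1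
    have e : Finset.Icc 1 2 = ({1, 2} : Finset ℕ) := rfl
    rw [e, Finset.sum_pair (by norm_num)] at h3
    simp only [Matrix.sub_apply, Matrix.add_apply, Matrix.smul_apply, smul_eq_mul, pow_one, Real.norm_eq_abs] at h3
    rw [abs_of_pos (by positivity : 0 < ε ^ (2 + 1))] at h3
    have e2 : (Sig ε a b - ε * S 1 a b) / ε ^ 2 - S 2 a b = (Sig ε a b - (ε * S 1 a b + ε ^ 2 * S 2 a b)) / ε ^ 2 := by
      field_simp; ring
    rw [e2, Real.norm_eq_abs, abs_div, abs_of_pos (by positivity : 0 < ε ^ 2), div_le_iff₀ (by positivity)]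
    calc _ ≤ _ := h3
      _ = _ := by ring
  obtain ⟨c1, hs1⟩ := hs1
  obtain ⟨c, hs0⟩ := hs0
  have hz : ∀ i j, ∀ᶠ ε in 𝓝[>] (0:ℝ), ∫ x : Fin n → ℝ,
      MvPolynomial.eval x (MvPolynomial.X i * MvPolynomial.X j - MvPolynomial.C (G i j)) *
      Real.exp (-MvPolynomial.eval x (quadP K + (quadP (Sig ε) + ε • quarP v))) = 0 := by
    intro i j
    have hsm : ∀ᶠ ε : ℝ in 𝓝[>] 0, c * ε * n < κ / 2 := by
      have : Tendsto (fun ε : ℝ => c * ε * n) (𝓝[>] 0) (𝓝 (c * 0 * n)) :=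
        ((tendsto_id.mono_left nhdsWithin_le_nhds).const_mul _).mul_const _
      rw [mul_zero, zero_mul] at this
      exact this.eventually (gt_mem_nhds (by positivity))
    filter_upwards [hs0, hpos, hsm] with ε h1 h2 h3
    have eA : quadP K + (quadP (Sig ε) + ε • quarP v) = quadP (K + Sig ε) + ε • quarP v := by
      rw [← add_assoc]; exact congrArg (fun q => q + ε • quarP v) (quadP_add K (Sig ε)).symm
    have hqA : ∀ x : Fin n → ℝ, κ / 2 * Qf x ≤ MvPolynomial.eval x (quadP (K + Sig ε) + ε • quarP v) := by
      intro x
      rw [← eA]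
      have q1 := (abs_le.1 (quad_bound (Sig ε) h1 x)).1
      have hv' : 0 ≤ ε * MvPolynomial.eval x (quarP v) := mul_nonneg h2.le (hqv x)
      have : c * ε * n * Qf x ≤ κ / 2 * Qf x := mul_le_mul_of_nonneg_right h3.le (Qf_nonneg x)
      simp only [map_add, MvPolynomial.smul_eval]
      linarith [hq x]
    rw [eA]
    have hfun : (fun x => ε * U x) = fun x => MvPolynomial.eval x (ε • quarP v) := by
      funext x; rw [hUe, MvPolynomial.smul_eval]
    have hD := (hSig ε h2).2
    rw [hfun] at hD
    exact station (K + Sig ε) G _ (by positivity) hqA (hne _)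
      (F_ge (Sig ε) G K _ (by positivity) hqA hdet hGK hGs (hne _) hD) i j
  have hgE0 : ∀ p : MvPolynomial (Fin n) ℝ, gE (quadP K) hκ hq p = 0 ↔
      ∫ x : Fin n → ℝ, MvPolynomial.eval x p * Real.exp (-MvPolynomial.eval x (quadP K)) = 0 := by
    intro p
    have := (gZ_pos (quadP K) hκ hq).ne'
    simp only [gE, LinearMap.coe_mk, AddHom.coe_mk, mul_eq_zero, inv_eq_zero, this, false_or]
  have hP : ∀ i j, ∫ x : Fin n → ℝ,
      MvPolynomial.eval x (MvPolynomial.X i * MvPolynomial.X j - MvPolynomial.C (G i j)) *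
      Real.exp (-MvPolynomial.eval x (quadP K)) = 0 := by
    intro i j
    rw [← hgE0, map_sub, hpair, MvPolynomial.C_eq_smul_one, map_smul, hE1]
    simp
  have hfin := fun i j => asym K hκ hq _ v hqv (fun ε => Sig ε) (S 1) (S 2) c1 hs1 hs2 (hz i j) (hP i j)
  exact alg_main G K hKG (fun a b => (hGs.apply a b).symm) (gE (quadP K) hκ hq) hE1 hIBP (S 1) (S 2) v
    (fun a b => ((hSsymm 1).apply a b).symm) (fun a b => ((hSsymm 2).apply a b).symm) (fun a b => (hv.apply a b).symm)
    (fun i j => (hgE0 _).2 (hfin i j).1) (fun i j => (hgE0 _).2 (hfin i j).2)
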